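/- arXiv:1312.0140 — 3 statements merged into one kernel-verified Lean document; each statement's English description precedes it below -/
import Mathlib

section
/- Let τ > 0 be constant, let I ⊆ ℝ be an open interval, and let κ : I → ℝ be differentiable with κ(s) > 1 and κ'(s) < 0 for all s ∈ I, satisfying κ'(s)² = κ(s)²·τ²·(κ(s)² − 1) for all s ∈ I. Then there exists a constant C ∈ ℝ such that for every s ∈ I one has τs + C ∈ (0, π/2) and κ(s) = 1/sin(τs + C). -/
open Real

/-- Along a decreasing solution `κ > 1` of `κ'² = κ²τ²(κ² - 1)`, the angle `arcsin (1 / κ)` grows at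
constant rate `τ`. -/
lemma hasDerivAt_arcsin_inv_of_ode {τ s κ' : ℝ} {κ : ℝ → ℝ} (hτ : 0 < τ)
    (hκ : HasDerivAt κ κ' s) (hgt : 1 < κ s) (hneg : κ' < 0)
    (hode : κ' ^ 2 = κ s ^ 2 * τ ^ 2 * (κ s ^ 2 - 1)) :
    HasDerivAt (fun t ↦ arcsin (κ t)⁻¹) τ s := by
  have hpos : 0 < κ s := by linarith
  have hinv_pos : 0 < (κ s)⁻¹ := inv_pos.mpr hpos
  have hinv_lt : (κ s)⁻¹ < 1 := inv_lt_one_of_one_lt₀ hgt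
  have hrad : 0 < 1 - (κ s)⁻¹ ^ 2 := by nlinarith
  have h := (hasDerivAt_arcsin (by linarith) hinv_lt.ne).comp s (hκ.fun_inv hpos.ne')
  suffices hrate_eq : τ = 1 / √(1 - (κ s)⁻¹ ^ 2) * (-κ' / κ s ^ 2) by
    rw [hrate_eq]
    exact h
  have hrate : 0 ≤ 1 / √(1 - (κ s)⁻¹ ^ 2) * (-κ' / κ s ^ 2) := by
    have : 0 ≤ -κ' := by linarith
    positivity
  refine (sq_eq_sq₀ hτ.le hrate).mp ?_
  have hsub : κ s ^ 2 - 1 ≠ 0 := by nlinarith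
  rw [mul_pow, div_pow, div_pow, sq_sqrt hrad.le, neg_sq, hode]
  field_simp

theorem constant_torsion_ODE_solutions_are_csc
    (τ a b : ℝ) (hτ : 0 < τ) (κ : ℝ → ℝ)
    (hdiff : ∀ s ∈ Set.Ioo a b, DifferentiableAt ℝ κ s)
    (hgt : ∀ s ∈ Set.Ioo a b, 1 < κ s)
    (hdec : ∀ s ∈ Set.Ioo a b, deriv κ s < 0)
    (hode : ∀ s ∈ Set.Ioo a b,
      (deriv κ s) ^ 2 = (κ s) ^ 2 * τ ^ 2 * ((κ s) ^ 2 - 1)) :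
    ∃ C : ℝ, ∀ s ∈ Set.Ioo a b,
      τ * s + C ∈ Set.Ioo 0 (π / 2) ∧ κ s = 1 / Real.sin (τ * s + C) := by
  have hangle (s : ℝ) (hs : s ∈ Set.Ioo a b) : HasDerivAt (fun t ↦ arcsin (κ t)⁻¹) τ s :=
    hasDerivAt_arcsin_inv_of_ode hτ (hdiff s hs).hasDerivAt (hgt s hs) (hdec s hs) (hode s hs)
  have hconst (s : ℝ) (hs : s ∈ Set.Ioo a b) :
      HasDerivAt (fun t ↦ arcsin (κ t)⁻¹ - τ * t) 0 s := by
    have h := (hangle s hs).fun_sub ((hasDerivAt_id s).const_mul τ)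
    rw [mul_one, sub_self] at h
    exact h
  obtain ⟨C, hC⟩ := isOpen_Ioo.exists_is_const_of_deriv_eq_zero isPreconnected_Ioo
    (fun s hs ↦ (hconst s hs).differentiableAt.differentiableWithinAt)
    (fun s hs ↦ (hconst s hs).deriv)
  refine ⟨C, fun s hs ↦ ?_⟩
  have hgt' := hgt s hs
  have hinv_pos : 0 < (κ s)⁻¹ := inv_pos.mpr (by linarith)
  have hinv_lt : (κ s)⁻¹ < 1 := inv_lt_one_of_one_lt₀ hgt'
  have hphase : τ * s + C = arcsin (κ s)⁻¹ := by linarith [hC s hs]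
  rw [hphase, sin_arcsin (by linarith) hinv_lt.le]
  exact ⟨⟨arcsin_pos.mpr hinv_pos, arcsin_lt_pi_div_two.mpr hinv_lt⟩, by simp⟩
end

section
/- Let τ > 0 be a real constant and define v : (0,1) → ℝ by v(t) = 1/(τ√(1−t²)). Suppose T, N, B : (0,1) → ℝ³ are differentiable and satisfy the Frenet system T'(t) = (v(t)/t)·N(t), N'(t) = −(v(t)/t)·T(t) + v(t)τ·B(t), B'(t) = −v(t)τ·N(t) for all t ∈ (0,1). Then T is three times differentiable on (0,1) and satisfies the third-order linear ODE t³(t²−1)τ²·T'''(t) + t²(5t²−2)τ²·T''(t) + t(3t²τ²−1)·T'(t) + T(t) = 0 for all t ∈ (0,1). -/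
/-- The speed `1 / (τ √(1 - t²))` has logarithmic derivative `t / (1 - t²)` on `(0, 1)`. -/
theorem hasDerivAt_one_div_mul_sqrt_one_sub_sq {τ t : ℝ} (hτ : 0 < τ)
    (ht : t ∈ Set.Ioo (0 : ℝ) 1) :
    HasDerivAt (fun s : ℝ => 1 / (τ * Real.sqrt (1 - s ^ 2)))
      (1 / (τ * Real.sqrt (1 - t ^ 2)) * (t / (1 - t ^ 2))) t := by
  have hpos : 0 < 1 - t ^ 2 := by nlinarith [ht.1, ht.2]
  have hs : 0 < Real.sqrt (1 - t ^ 2) := Real.sqrt_pos.2 hpos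
  have hsq : Real.sqrt (1 - t ^ 2) ^ 2 = 1 - t ^ 2 := Real.sq_sqrt hpos.le
  have hd := ((((hasDerivAt_id t).pow 2).const_sub 1).sqrt hpos.ne').const_mul τ
  have hd' := hd.fun_inv (mul_pos hτ hs).ne'
  simp only [one_div]
  refine hd'.congr_deriv ?_
  simp only [id, Pi.pow_apply]
  rw [← hsq]
  field_simp
  norm_num

theorem frenet_tangent_third_order_ODE
    (τ : ℝ) (hτ : 0 < τ)
    (v : ℝ → ℝ) (hv : ∀ t, v t = 1 / (τ * Real.sqrt (1 - t ^ 2)))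
    (T N B : ℝ → EuclideanSpace ℝ (Fin 3))
    (hTdiff : ∀ t ∈ Set.Ioo (0 : ℝ) 1, DifferentiableAt ℝ T t)
    (hNdiff : ∀ t ∈ Set.Ioo (0 : ℝ) 1, DifferentiableAt ℝ N t)
    (hBdiff : ∀ t ∈ Set.Ioo (0 : ℝ) 1, DifferentiableAt ℝ B t)
    (hT' : ∀ t ∈ Set.Ioo (0 : ℝ) 1, deriv T t = (v t / t) • N t)
    (hN' : ∀ t ∈ Set.Ioo (0 : ℝ) 1,
      deriv N t = -(v t / t) • T t + (v t * τ) • B t)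
    (hB' : ∀ t ∈ Set.Ioo (0 : ℝ) 1, deriv B t = -(v t * τ) • N t) :
    (∀ t ∈ Set.Ioo (0 : ℝ) 1,
      DifferentiableAt ℝ (deriv T) t ∧ DifferentiableAt ℝ (deriv (deriv T)) t) ∧
    ∀ t ∈ Set.Ioo (0 : ℝ) 1,
      (t ^ 3 * (t ^ 2 - 1) * τ ^ 2) • deriv (deriv (deriv T)) t +
        (t ^ 2 * (5 * t ^ 2 - 2) * τ ^ 2) • deriv (deriv T) t +
        (t * (3 * t ^ 2 * τ ^ 2 - 1)) • deriv T t + T t = 0 := by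
  have hpos : ∀ t ∈ Set.Ioo (0 : ℝ) 1, 0 < 1 - t ^ 2 := fun t ht => by
    nlinarith [ht.1, ht.2]
  have hvsq : ∀ t ∈ Set.Ioo (0 : ℝ) 1, v t ^ 2 = 1 / (τ ^ 2 * (1 - t ^ 2)) := fun t ht => by
    rw [hv, div_pow, mul_pow, Real.sq_sqrt (hpos t ht).le, one_pow]
  have hvd : ∀ t ∈ Set.Ioo (0 : ℝ) 1, HasDerivAt v (v t * (t / (1 - t ^ 2))) t := fun t ht => by
    have h := hasDerivAt_one_div_mul_sqrt_one_sub_sq hτ ht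
    rwa [← funext hv, ← hv t] at h
  have hTd : ∀ t ∈ Set.Ioo (0 : ℝ) 1, HasDerivAt T (deriv T t) t := fun t ht =>
    (hTdiff t ht).hasDerivAt
  have hBd : ∀ t ∈ Set.Ioo (0 : ℝ) 1, HasDerivAt B (-(t * τ) • deriv T t) t := fun t ht => by
    refine (hBdiff t ht).hasDerivAt.congr_deriv ?_
    have ht0 := ht.1.ne'
    rw [hB' t ht, hT' t ht]
    match_scalars
    field_simp
  have hT2 : ∀ t ∈ Set.Ioo (0 : ℝ) 1, HasDerivAt (deriv T)
      (((2 * t ^ 2 - 1) / (t * (1 - t ^ 2))) • deriv T t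
        - (1 / (τ ^ 2 * (t ^ 2 * (1 - t ^ 2)))) • T t
        + (1 / (τ * (t * (1 - t ^ 2)))) • B t) t := fun t ht => by
    have ht0 := ht.1.ne'
    have hp := (hpos t ht).ne'
    have hsq := hvsq t ht
    have h := ((hvd t ht).fun_div (hasDerivAt_id' t) ht0).fun_smul (hNdiff t ht).hasDerivAt
    have heq : deriv T =ᶠ[nhds t] fun s => (v s / s) • N s := by
      filter_upwards [Ioo_mem_nhds ht.1 ht.2] with s hs using hT' s hs
    refine (h.congr_of_eventuallyEq heq).congr_deriv ?_
    rw [hN' t ht, hT' t ht]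
    match_scalars
    · have : v t / t * (-(v t / t)) = -(v t ^ 2 / t ^ 2) := by ring
      simp only [mul_one, mul_neg] at this ⊢
      rw [this, hsq]
      field_simp
    · have : v t / t * (v t * τ) = v t ^ 2 * τ / t := by ring
      simp only [mul_one]
      rw [this, hsq]
      field_simp
    · field_simp
      ring
  have hT3 : ∀ t ∈ Set.Ioo (0 : ℝ) 1, HasDerivAt (deriv (deriv T))
      (-(1 / (t ^ 3 * (t ^ 2 - 1) * τ ^ 2)) •
        ((t ^ 2 * (5 * t ^ 2 - 2) * τ ^ 2) • deriv (deriv T) t +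
          (t * (3 * t ^ 2 * τ ^ 2 - 1)) • deriv T t + T t)) t := fun t ht => by
    have ht0 := ht.1.ne'
    have hp := (hpos t ht).ne'
    have hn : t ^ 2 - 1 ≠ 0 := (sub_neg.2 (sub_pos.1 (hpos t ht))).ne
    have hq : HasDerivAt (fun s : ℝ => 1 - s ^ 2) (-(2 * t)) t := by
      simpa using (hasDerivAt_pow 2 t).const_sub 1
    have hn2 : HasDerivAt (fun s : ℝ => 2 * s ^ 2 - 1) (4 * t) t :=
      (((hasDerivAt_pow 2 t).const_mul 2).sub_const 1).congr_deriv (by norm_num; ring)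
    have ha := hn2.fun_div ((hasDerivAt_id' t).fun_mul hq) (mul_ne_zero ht0 hp)
    have hb := (hasDerivAt_const t (1 : ℝ)).fun_div
      (((hasDerivAt_pow 2 t).fun_mul hq).const_mul (τ ^ 2)) (by positivity)
    have hc := (hasDerivAt_const t (1 : ℝ)).fun_div
      (((hasDerivAt_id' t).fun_mul hq).const_mul τ) (by positivity)
    have h := ((ha.fun_smul (hT2 t ht)).fun_sub (hb.fun_smul (hTd t ht))).fun_add
      (hc.fun_smul (hBd t ht))
    have heq : deriv (deriv T) =ᶠ[nhds t] fun s =>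
        ((2 * s ^ 2 - 1) / (s * (1 - s ^ 2))) • deriv T s
        - (1 / (τ ^ 2 * (s ^ 2 * (1 - s ^ 2)))) • T s
        + (1 / (τ * (s * (1 - s ^ 2)))) • B s := by
      filter_upwards [Ioo_mem_nhds ht.1 ht.2] with s hs using (hT2 s hs).deriv
    refine (h.congr_of_eventuallyEq heq).congr_deriv ?_
    rw [(hT2 t ht).deriv]
    match_scalars <;> field_simp <;> ring
  refine ⟨fun t ht => ⟨(hT2 t ht).differentiableAt, (hT3 t ht).differentiableAt⟩, fun t ht => ?_⟩
  have hc : t ^ 3 * (t ^ 2 - 1) * τ ^ 2 ≠ 0 :=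
    mul_ne_zero (mul_ne_zero (pow_ne_zero 3 ht.1.ne') (sub_neg.2 (sub_pos.1 (hpos t ht))).ne)
      (pow_ne_zero 2 hτ.ne')
  rw [(hT3 t ht).deriv, smul_smul, mul_neg, mul_one_div_cancel hc]
  module
end

section
/- Let τ > 0 be real and define S₁ : (0,1) → ℂ by S₁(t) = i·t·∑_{n=0}^∞ [ (1/2)ₙ (1/2)ₙ (3/2)ₙ / ( (3/2 − i/(2τ))ₙ (3/2 + i/(2τ))ₙ · n! ) ] · t^{2n}. Then this series converges for every t ∈ (0,1), S₁ is three times differentiable on (0,1), and τ²t³(t²−1)·S₁'''(t) + τ²t²(5t²−2)·S₁''(t) + t(3t²τ²−1)·S₁'(t) + S₁(t) = 0 for all t ∈ (0,1). -/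
/-- The Pochhammer symbol (ascending factorial) `(x)ₙ` for complex `x`. -/
noncomputable def poch (x : ℂ) (n : ℕ) : ℂ := (ascPochhammer ℂ n).eval x

/-- The coefficients of the hypergeometric series defining `S₁`. -/
noncomputable def S1coef (τ : ℝ) (n : ℕ) : ℂ :=
  poch (1 / 2) n * poch (1 / 2) n * poch (3 / 2) n /
    (poch (3 / 2 - Complex.I / (2 * τ)) n * poch (3 / 2 + Complex.I / (2 * τ)) n *
      n.factorial)

/-- `S₁(t) = i t ⬝ ₃F₂(1/2, 1/2, 3/2; 3/2 − i/(2τ), 3/2 + i/(2τ); t²)`. -/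
noncomputable def S1 (τ : ℝ) (t : ℝ) : ℂ :=
  Complex.I * t * ∑' n : ℕ, S1coef τ n * (t : ℂ) ^ (2 * n)

/-- The termwise `j`-th derivative of the series `∑ a n * t ^ e n`. -/
noncomputable def termwiseDeriv (a : ℕ → ℂ) (e : ℕ → ℕ) (j : ℕ) (t : ℝ) : ℂ :=
  ∑' n, a n * ((e n).descFactorial j : ℂ) * (t : ℂ) ^ (e n - j)

theorem descFactorial_mul_pow_sub_mul_pow {R : Type*} [CommSemiring R] (k j : ℕ) (x : R) :
    (k.descFactorial j : R) * x ^ (k - j) * x ^ j = k.descFactorial j * x ^ k := by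
  rcases lt_or_ge k j with h | h
  · simp [Nat.descFactorial_eq_zero_iff_lt.mpr h]
  · rw [mul_assoc, ← pow_add, Nat.sub_add_cancel h]

theorem summable_descFactorial_mul_pow_sub {e : ℕ → ℕ} (he : Function.Injective e) (j : ℕ)
    {r : ℝ} (hr0 : 0 < r) (hr1 : r < 1) :
    Summable fun n => ((e n).descFactorial j : ℝ) * r ^ (e n - j) := by
  suffices h : Summable fun k : ℕ => (k.descFactorial j : ℝ) * r ^ (k - j) from
    h.comp_injective he
  have hr : ‖r‖ < 1 := by rwa [Real.norm_of_nonneg hr0.le]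
  have hs : Summable fun k : ℕ => (k : ℝ) ^ j * r ^ k / r ^ j :=
    (summable_pow_mul_geometric_of_norm_lt_one j hr).div_const (r ^ j)
  refine hs.of_nonneg_of_le (fun k => by positivity) fun k => ?_
  rw [le_div_iff₀ (by positivity), descFactorial_mul_pow_sub_mul_pow]
  gcongr
  exact_mod_cast Nat.descFactorial_le_pow k j

section

variable {a : ℕ → ℂ} {e : ℕ → ℕ}

theorem norm_termwiseDeriv_term_le (ha : ∀ n, ‖a n‖ ≤ 1) (j n : ℕ) {r t : ℝ} (ht : |t| ≤ r) :
    ‖a n * ((e n).descFactorial j : ℂ) * (t : ℂ) ^ (e n - j)‖ ≤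
      ((e n).descFactorial j : ℝ) * r ^ (e n - j) := by
  rw [norm_mul, norm_mul, norm_pow, Complex.norm_natCast, Complex.norm_real, Real.norm_eq_abs]
  gcongr
  exact mul_le_of_le_one_left (by positivity) (ha n)

theorem summable_termwiseDeriv (ha : ∀ n, ‖a n‖ ≤ 1) (he : Function.Injective e) (j : ℕ)
    {t : ℝ} (ht : |t| < 1) :
    Summable fun n => a n * ((e n).descFactorial j : ℂ) * (t : ℂ) ^ (e n - j) := by
  obtain ⟨r, hr, hr1⟩ := exists_between ht
  exact (summable_descFactorial_mul_pow_sub he j ((abs_nonneg t).trans_lt hr) hr1).of_norm_bounded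
    fun n => norm_termwiseDeriv_term_le ha j n hr.le

theorem hasDerivAt_termwiseDeriv (ha : ∀ n, ‖a n‖ ≤ 1) (he : Function.Injective e) (j : ℕ)
    {t : ℝ} (ht : |t| < 1) :
    HasDerivAt (termwiseDeriv a e j) (termwiseDeriv a e (j + 1) t) t := by
  obtain ⟨r, hr, hr1⟩ := exists_between ht
  have hr0 : 0 < r := (abs_nonneg t).trans_lt hr
  refine hasDerivAt_tsum_of_isPreconnected (t := Set.Ioo (-r) r) (y₀ := t)
    (summable_descFactorial_mul_pow_sub he (j + 1) hr0 hr1) isOpen_Ioo isPreconnected_Ioo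
    (fun n y _ => ?_)
    (fun n y hy => norm_termwiseDeriv_term_le ha (j + 1) n (abs_lt.mpr hy).le)
    (abs_lt.mp hr) (summable_termwiseDeriv ha he j ht) (abs_lt.mp hr)
  refine (((Complex.ofRealCLM.hasDerivAt (x := y)).fun_pow (e n - j)).const_mul
    (a n * ((e n).descFactorial j : ℂ))).congr_deriv ?_
  simp only [Nat.descFactorial_succ, Nat.sub_add_eq, Complex.ofRealCLM_apply]
  push_cast
  ring

theorem hasSum_pow_mul_termwiseDeriv (ha : ∀ n, ‖a n‖ ≤ 1) (he : Function.Injective e) (j : ℕ)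
    {t : ℝ} (ht : |t| < 1) :
    HasSum (fun n => a n * ((e n).descFactorial j : ℂ) * (t : ℂ) ^ e n)
      ((t : ℂ) ^ j * termwiseDeriv a e j t) := by
  refine ((summable_termwiseDeriv ha he j ht).hasSum.mul_left ((t : ℂ) ^ j)).congr_fun fun n => ?_
  linear_combination (-a n) * descFactorial_mul_pow_sub_mul_pow (e n) j (t : ℂ)

end

theorem poch_zero (x : ℂ) : poch x 0 = 1 := by simp [poch]

theorem poch_succ (x : ℂ) (n : ℕ) : poch x (n + 1) = poch x n * (x + n) := by
  simp [poch, ascPochhammer_succ_eval]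

theorem S1coef_zero (τ : ℝ) : S1coef τ 0 = 1 := by simp [S1coef, poch_zero]

theorem S1coef_succ {τ : ℝ} (hτ : 0 < τ) (n : ℕ) :
    S1coef τ (n + 1) =
      (((2 * n + 1) ^ 2 * (2 * n + 3) * τ ^ 2 /
        ((2 * n + 2) * (τ ^ 2 * (2 * n + 3) ^ 2 + 1)) : ℝ) : ℂ) * S1coef τ n := by
  have hτ' : (τ : ℂ) ≠ 0 := by exact_mod_cast hτ.ne'
  have hden : (3 / 2 - Complex.I / (2 * τ) + n) * (3 / 2 + Complex.I / (2 * τ) + n) =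
      (τ ^ 2 * (2 * n + 3) ^ 2 + 1 : ℂ) / (4 * τ ^ 2) := by
    field_simp
    linear_combination (-4 : ℂ) * Complex.I_sq
  have hpos : (τ ^ 2 * (2 * n + 3) ^ 2 + 1 : ℂ) ≠ 0 := by
    exact_mod_cast (by positivity : (τ ^ 2 * (2 * n + 3) ^ 2 + 1 : ℝ) ≠ 0)
  have hn : (n + 1 : ℂ) ≠ 0 := by exact_mod_cast n.succ_ne_zero
  have hn' : (2 * n + 2 : ℂ) ≠ 0 := by
    rw [show (2 * n + 2 : ℂ) = 2 * (n + 1) by ring]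
    exact mul_ne_zero two_ne_zero hn
  have hratio : (1 / 2 + n : ℂ) * (1 / 2 + n) * (3 / 2 + n) /
      ((3 / 2 - Complex.I / (2 * τ) + n) * (3 / 2 + Complex.I / (2 * τ) + n) * (n + 1)) =
      (2 * n + 1) ^ 2 * (2 * n + 3) * τ ^ 2 /
        ((2 * n + 2) * (τ ^ 2 * (2 * n + 3) ^ 2 + 1)) := by
    rw [hden]
    field_simp
    ring
  push_cast
  rw [← hratio]
  simp only [S1coef, poch_succ, Nat.factorial_succ]
  push_cast
  rw [div_mul_div_comm]
  congr 1 <;> ring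

theorem norm_S1coef_le_one {τ : ℝ} (hτ : 0 < τ) (n : ℕ) : ‖S1coef τ n‖ ≤ 1 := by
  induction n with
  | zero => simp [S1coef_zero]
  | succ n ih =>
    rw [S1coef_succ hτ, norm_mul, Complex.norm_real, Real.norm_of_nonneg (by positivity)]
    refine mul_le_one₀ ?_ (norm_nonneg _) ih
    rw [div_le_one (by positivity)]
    have h : (2 * n + 1 : ℝ) ^ 2 ≤ (2 * n + 2) * (2 * n + 3) := by
      nlinarith [n.cast_nonneg (α := ℝ)]
    have h2 := mul_le_mul_of_nonneg_right h
      (by positivity : (0 : ℝ) ≤ (2 * n + 3) * τ ^ 2)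
    nlinarith [n.cast_nonneg (α := ℝ)]

theorem S1coef_recurrence {τ : ℝ} (hτ : 0 < τ) (n : ℕ) :
    (2 * n + 2) * (τ ^ 2 * (2 * n + 3) ^ 2 + 1) * S1coef τ (n + 1) =
      τ ^ 2 * (2 * n + 1) ^ 2 * (2 * n + 3) * S1coef τ n := by
  have hpos : ((2 * n + 2) * (τ ^ 2 * (2 * n + 3) ^ 2 + 1) : ℂ) ≠ 0 := by
    exact_mod_cast (by positivity : ((2 * n + 2) * (τ ^ 2 * (2 * n + 3) ^ 2 + 1) : ℝ) ≠ 0)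
  rw [S1coef_succ hτ]
  push_cast
  rw [← mul_assoc, mul_div_cancel₀ _ hpos]
  ring

theorem S1_eq_termwiseDeriv (τ : ℝ) :
    S1 τ = termwiseDeriv (fun n => Complex.I * S1coef τ n) (fun n => 2 * n + 1) 0 := by
  ext t
  rw [S1, termwiseDeriv, ← tsum_mul_left]
  refine tsum_congr fun n => ?_
  simp only [Nat.descFactorial_zero, Nat.sub_zero, Nat.cast_one]
  ring

theorem injective_two_mul_add_one : Function.Injective fun n : ℕ => 2 * n + 1 :=
  fun _ _ h => by simpa using h

theorem termwiseDeriv_ode {τ : ℝ} (hτ : 0 < τ) {t : ℝ} (ht : |t| < 1) {g : ℕ → ℂ}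
    (hg : ∀ j, g j =
      termwiseDeriv (fun n => Complex.I * S1coef τ n) (fun n => 2 * n + 1) j t) :
    (τ : ℂ) ^ 2 * t ^ 3 * (t ^ 2 - 1) * g 3 + (τ : ℂ) ^ 2 * t ^ 2 * (5 * t ^ 2 - 2) * g 2 +
      t * (3 * t ^ 2 * τ ^ 2 - 1) * g 1 + g 0 = 0 := by
  have hs : ∀ j, HasSum (fun n : ℕ => Complex.I * S1coef τ n *
      ((2 * n + 1).descFactorial j : ℂ) * (t : ℂ) ^ (2 * n + 1)) ((t : ℂ) ^ j * g j) :=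
    fun j => hg j ▸ hasSum_pow_mul_termwiseDeriv
      (fun n => by simpa using norm_S1coef_le_one hτ n) injective_two_mul_add_one j ht
  have hd2 (n : ℕ) : ((2 * n + 1).descFactorial 2 : ℂ) = (2 * n + 1) * (2 * n) := by
    simp [Nat.descFactorial_succ, mul_comm]
  have hd3 (n : ℕ) : ((2 * n + 1).descFactorial 3 : ℂ) = (2 * n + 1) * (2 * n) * (2 * n - 1) := by
    rw [Nat.descFactorial_succ, Nat.cast_mul, hd2]
    cases n with
    | zero => simp
    | succ n =>
      rw [show 2 * (n + 1) + 1 - 2 = 2 * n + 1 by omega]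
      push_cast
      ring
  have hlow := (((hs 3).mul_left ((τ : ℂ) ^ 2)).add ((hs 2).mul_left (2 * (τ : ℂ) ^ 2))).add
    ((hs 1).sub (hs 0))
  have hhigh := ((((hs 3).add ((hs 2).mul_left 5)).add ((hs 1).mul_left 3)).mul_left
    ((τ : ℂ) ^ 2 * t ^ 2))
  rw [← hasSum_nat_add_iff' 1] at hlow
  have heq := hhigh.unique (hlow.congr_fun ?_)
  · simp [Nat.descFactorial_succ] at heq
    linear_combination heq
  · intro n
    simp only [hd2, hd3, Nat.descFactorial_zero, Nat.descFactorial_one]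
    push_cast
    linear_combination (-Complex.I * (t : ℂ) ^ (2 * n + 3)) * S1coef_recurrence hτ n

theorem S1_solves_tangent_ODE (τ : ℝ) (hτ : 0 < τ) :
    (∀ t ∈ Set.Ioo (0 : ℝ) 1, Summable fun n : ℕ => S1coef τ n * (t : ℂ) ^ (2 * n)) ∧
    (∀ t ∈ Set.Ioo (0 : ℝ) 1,
      DifferentiableAt ℝ (S1 τ) t ∧ DifferentiableAt ℝ (deriv (S1 τ)) t ∧
        DifferentiableAt ℝ (deriv (deriv (S1 τ))) t) ∧
    ∀ t ∈ Set.Ioo (0 : ℝ) 1,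
      (τ : ℂ) ^ 2 * t ^ 3 * (t ^ 2 - 1) * deriv (deriv (deriv (S1 τ))) t +
        (τ : ℂ) ^ 2 * t ^ 2 * (5 * t ^ 2 - 2) * deriv (deriv (S1 τ)) t +
        t * (3 * t ^ 2 * τ ^ 2 - 1) * deriv (S1 τ) t + S1 τ t = 0 := by
  set g := termwiseDeriv (fun n => Complex.I * S1coef τ n) (fun n => 2 * n + 1)
  have habs {t : ℝ} (ht : t ∈ Set.Ioo (0 : ℝ) 1) : |t| < 1 :=
    abs_lt.mpr ⟨by linarith [ht.1], ht.2⟩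
  have hderiv (j : ℕ) {t : ℝ} (ht : t ∈ Set.Ioo (0 : ℝ) 1) : HasDerivAt (g j) (g (j + 1) t) t :=
    hasDerivAt_termwiseDeriv (fun n => by simpa using norm_S1coef_le_one hτ n)
      injective_two_mul_add_one j (habs ht)
  have hS : S1 τ = g 0 := S1_eq_termwiseDeriv τ
  have hlift {f : ℝ → ℂ} {j : ℕ} (hf : Set.EqOn f (g j) (Set.Ioo 0 1)) {t : ℝ}
      (ht : t ∈ Set.Ioo (0 : ℝ) 1) : HasDerivAt f (g (j + 1) t) t :=
    (hderiv j ht).congr_of_eventuallyEq (hf.eventuallyEq_of_mem (isOpen_Ioo.mem_nhds ht))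
  have h0 : Set.EqOn (S1 τ) (g 0) (Set.Ioo 0 1) := fun t _ => congrFun hS t
  have h1 : Set.EqOn (deriv (S1 τ)) (g 1) (Set.Ioo 0 1) := fun t ht => (hlift h0 ht).deriv
  have h2 : Set.EqOn (deriv (deriv (S1 τ))) (g 2) (Set.Ioo 0 1) :=
    fun t ht => (hlift h1 ht).deriv
  refine ⟨fun t ht => ?_, fun t ht => ⟨(hlift h0 ht).differentiableAt,
    (hlift h1 ht).differentiableAt, (hlift h2 ht).differentiableAt⟩, fun t ht => ?_⟩
  · simpa using summable_termwiseDeriv (e := fun n => 2 * n) (norm_S1coef_le_one hτ)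
      (fun _ _ h => by simpa using h) 0 (habs ht)
  · rw [(hlift h2 ht).deriv, h2 ht, h1 ht, h0 ht]
    exact termwiseDeriv_ode hτ (habs ht) (g := fun j => g j t) fun _ => rfl
end
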